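/- Let G be a simple graph on a finite vertex set, and let A and B be disjoint finite sets of vertices of G such that every vertex of B has at least 3 neighbors in A. Then there exists a subset X₁ ⊆ A such that, setting Y₁ = {b ∈ B : b has a neighbor in X₁}, X₂ = A \ X₁, and Y₂ = B \ Y₁, the following hold: (i) |Y₁| ≥ 2|X₁|; (ii) every vertex of X₂ has at most one neighbor in Y₂; (iii) every vertex of Y₂ has at least 3 neighbors in X₂; and (iv) |Y₂| ≤ 3|X₂|. -/

import Mathlib

/-- The greedy partition of Case 4: if `A` and `B` are disjoint sets of vertices of a
simple graph `G` such that every vertex of `B` has at least 3 neighbors in `A`, then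
there is a subset `X₁ ⊆ A` such that, with `Y₁` the set of vertices of `B` having a
neighbor in `X₁`, `X₂ = A \ X₁` and `Y₂ = B \ Y₁`, we have `|Y₁| ≥ 2|X₁|`, every
vertex of `X₂` has at most one neighbor in `Y₂`, every vertex of `Y₂` has at least 3
neighbors in `X₂`, and `|Y₂| ≤ 3|X₂|`. -/
theorem greedy_partition {V : Type*} [Fintype V] [DecidableEq V]
    (G : SimpleGraph V) [DecidableRel G.Adj] (A B : Finset V)
    (hdisj : Disjoint A B)
    (hB : ∀ b ∈ B, 3 ≤ (A.filter (fun a => G.Adj b a)).card) :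
    ∃ X₁ ⊆ A,
      2 * X₁.card ≤ (B.filter (fun b => ∃ a ∈ X₁, G.Adj b a)).card ∧
      (∀ a ∈ A \ X₁,
        (((B \ B.filter (fun b => ∃ x ∈ X₁, G.Adj b x)).filter
            (fun b => G.Adj a b)).card ≤ 1)) ∧
      (∀ b ∈ B \ B.filter (fun b => ∃ x ∈ X₁, G.Adj b x),
        3 ≤ ((A \ X₁).filter (fun a => G.Adj b a)).card) ∧
      (B \ B.filter (fun b => ∃ x ∈ X₁, G.Adj b x)).card ≤ 3 * (A \ X₁).card := by
  obtain ⟨X, hX, hmax⟩ := Finset.exists_max_image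
    (A.powerset.filter fun X => 2 * X.card ≤ (B.filter (fun b => ∃ a ∈ X, G.Adj b a)).card)
    Finset.card ⟨∅, by simp⟩
  simp only [Finset.mem_filter, Finset.mem_powerset] at hX hmax
  obtain ⟨hXA, hXcard⟩ := hX
  have h_few : ∀ a ∈ A \ X, ((B \ B.filter (fun b => ∃ x ∈ X, G.Adj b x)).filter
      (fun b => G.Adj a b)).card ≤ 1 := by
    intro a ha
    rw [Finset.mem_sdiff] at ha
    by_contra! hlt
    have hsub : B.filter (fun b => ∃ x ∈ X, G.Adj b x) ∪
        (B \ B.filter (fun b => ∃ x ∈ X, G.Adj b x)).filter (fun b => G.Adj a b) ⊆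
        B.filter (fun b => ∃ x ∈ insert a X, G.Adj b x) := by
      intro b hb
      simp only [Finset.mem_union, Finset.mem_filter, Finset.mem_sdiff] at hb
      rw [Finset.mem_filter]
      rcases hb with ⟨hb, x, hx, hbx⟩ | ⟨⟨hb, -⟩, hab⟩
      · exact ⟨hb, x, Finset.mem_insert_of_mem hx, hbx⟩
      · exact ⟨hb, a, Finset.mem_insert_self a X, hab.symm⟩
    have hle := Finset.card_le_card hsub
    rw [Finset.card_union_of_disjoint
      (Finset.disjoint_sdiff.mono_right (Finset.filter_subset _ _))] at hle
    have hins := Finset.card_insert_of_notMem ha.2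
    have hcontra := hmax (insert a X) ⟨Finset.insert_subset ha.1 hXA, by omega⟩
    omega
  have h_many : ∀ b ∈ B \ B.filter (fun b => ∃ x ∈ X, G.Adj b x),
      3 ≤ ((A \ X).filter (fun a => G.Adj b a)).card := by
    intro b hb
    simp only [Finset.mem_sdiff, Finset.mem_filter, not_and, not_exists] at hb
    refine (hB b hb.1).trans (Finset.card_le_card fun a ha => ?_)
    rw [Finset.mem_filter] at ha
    rw [Finset.mem_filter, Finset.mem_sdiff]
    exact ⟨⟨ha.1, fun haX => hb.2 hb.1 a haX ha.2⟩, ha.2⟩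
  refine ⟨X, hXA, hXcard, h_few, h_many, ?_⟩
  have hcount := Finset.card_mul_le_card_mul (fun b a => G.Adj b a) h_many
    (t := A \ X) (n := 1) fun a ha => by
      simpa only [Finset.bipartiteBelow, G.adj_comm a] using h_few a ha
  omega
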